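/- Let K be a compact Hausdorff space and let E be a real GL-space. Then the space C(K, E) of continuous E-valued functions on K, with the supremum norm, is a GL-space. -/

import Mathlib

open Metric Set

/-- The slice of the closed unit ball determined by a norm-one functional `f` and `ε`:
`S(f, ε) = {x ∈ B_E : f x > 1 - ε}`. -/
def glSlice {E : Type*} [NormedAddCommGroup E] [NormedSpace ℝ E]
    (f : E →L[ℝ] ℝ) (ε : ℝ) : Set E :=
  {x | ‖x‖ ≤ 1 ∧ 1 - ε < f x}

/-- A (real) Banach space is a generalized-lush space (GL-space) if for every `x` in the
unit sphere and every `ε > 0` there is a norm-one functional `f` with `x ∈ S(f, ε)` and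
`dist(y, S(f, ε)) + dist(y, -S(f, ε)) < 2 + ε` for every `y` in the unit sphere. -/
def IsGLSpace (E : Type*) [NormedAddCommGroup E] [NormedSpace ℝ E] : Prop :=
  ∀ x : E, ‖x‖ = 1 → ∀ ε : ℝ, 0 < ε →
    ∃ f : E →L[ℝ] ℝ, ‖f‖ = 1 ∧ x ∈ glSlice f ε ∧
      ∀ y : E, ‖y‖ = 1 →
        infDist y (glSlice f ε) + infDist y (-(glSlice f ε)) < 2 + ε

lemma convex_glSlice {E : Type*} [NormedAddCommGroup E] [NormedSpace ℝ E]
    (f : E →L[ℝ] ℝ) (ε : ℝ) : Convex ℝ (glSlice f ε) := by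
  have h : glSlice f ε = closedBall 0 1 ∩ {x | 1 - ε < f x} := by
    ext x
    simp [glSlice]
  rw [h]
  exact (convex_closedBall 0 1).inter (convex_halfSpace_gt f.toLinearMap.isLinear _)

/-- If a nonempty slice satisfies the generalized-lush estimate on the unit sphere, then it
satisfies it on the whole unit ball, with the two distances witnessed by points. -/
lemma exists_mem_glSlice_norm_add_norm_lt {E : Type*} [NormedAddCommGroup E] [NormedSpace ℝ E]
    {f : E →L[ℝ] ℝ} {ε : ℝ} (hε : 0 < ε) {x : E} (hx : x ∈ glSlice f ε)
    (hf : ∀ y : E, ‖y‖ = 1 →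
      infDist y (glSlice f ε) + infDist y (-(glSlice f ε)) < 2 + ε)
    {y : E} (hy : ‖y‖ ≤ 1) :
    ∃ a ∈ glSlice f ε, ∃ b ∈ -(glSlice f ε), ‖y - a‖ + ‖y - b‖ < 2 + ε := by
  have hne : (glSlice f ε).Nonempty := ⟨x, hx⟩
  have hx1 : ‖x‖ ≤ 1 := hx.1
  have hx' : -x ∈ -(glSlice f ε) := by simpa using hx
  rcases eq_or_ne y 0 with rfl | hy0
  · refine ⟨x, hx, -x, hx', ?_⟩
    simp only [zero_sub, norm_neg]
    linarith
  have hr : 0 < ‖y‖ := norm_pos_iff.2 hy0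
  set r := ‖y‖ with hr_def
  set z := r⁻¹ • y with hz_def
  have hz : ‖z‖ = 1 := norm_smul_inv_norm (𝕜 := ℝ) hy0
  have hyz : y = r • z := by rw [hz_def, smul_inv_smul₀ hr.ne']
  have hlt := hf z hz
  set η := (2 + ε - (infDist z (glSlice f ε) + infDist z (-(glSlice f ε)))) / 2 with hη_def
  have hη : 0 < η := by linarith
  obtain ⟨a, ha, hza⟩ := (infDist_lt_iff hne).1 (lt_add_of_pos_right (infDist z _) hη)
  obtain ⟨b, hb, hzb⟩ :=
    (infDist_lt_iff hne.neg).1 (lt_add_of_pos_right (infDist z (-(glSlice f ε))) hη)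
  rw [dist_eq_norm] at hza hzb
  have hconv := convex_glSlice f ε
  have key : ∀ c w : E, ‖w‖ ≤ 1 → ‖y - (r • c + (1 - r) • w)‖ ≤ r * ‖z - c‖ + (1 - r) := by
    intro c w hw
    calc ‖y - (r • c + (1 - r) • w)‖ = ‖r • (z - c) - (1 - r) • w‖ := by
          rw [hyz, smul_sub]
          congr 1
          abel
      _ ≤ ‖r • (z - c)‖ + ‖(1 - r) • w‖ := norm_sub_le _ _
      _ = r * ‖z - c‖ + (1 - r) * ‖w‖ := by
          rw [norm_smul_of_nonneg hr.le, norm_smul_of_nonneg (by linarith)]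
      _ ≤ r * ‖z - c‖ + (1 - r) := by
          have := mul_le_of_le_one_right (by linarith : 0 ≤ 1 - r) hw
          linarith
  refine ⟨r • a + (1 - r) • x, hconv ha hx hr.le (by linarith) (by ring),
    r • b + (1 - r) • (-x), hconv.neg hb hx' hr.le (by linarith) (by ring), ?_⟩
  have h1 := key a x hx1
  have h2 := key b (-x) (by rwa [norm_neg])
  have h3 : r * (‖z - a‖ + ‖z - b‖) < r * (2 + ε) :=
    mul_lt_mul_of_pos_left (by linarith) hr
  have h4 : r * ε ≤ ε := mul_le_of_le_one_left hε.le hy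
  linarith

/-- The value of a function in the unit ball of `C(K, E)` at one point can be changed to any `u`
in the unit ball of `E`, staying in the unit ball and moving the function by hardly more than its
value at that point. -/
lemma ContinuousMap.exists_apply_eq_norm_sub_le {K : Type*} [TopologicalSpace K] [CompactSpace K]
    {E : Type*} [NormedAddCommGroup E] [NormedSpace ℝ E]
    {g : C(K, E)} (hg : ‖g‖ ≤ 1) (t₀ : K) {u : E} (hu : ‖u‖ ≤ 1) {δ : ℝ} (hδ : 0 < δ) :
    ∃ h : C(K, E), ‖h‖ ≤ 1 ∧ h t₀ = u ∧ ‖g - h‖ ≤ ‖g t₀ - u‖ + δ := by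
  let φ : K → ℝ := fun t ↦ max 0 (1 - ‖g t - g t₀‖ / δ)
  have hφ : Continuous φ := by fun_prop
  have hφ0 (t : K) : 0 ≤ φ t := le_max_left _ _
  have hφ1 (t : K) : φ t ≤ 1 := max_le zero_le_one <| by
    linarith [show 0 ≤ ‖g t - g t₀‖ / δ by positivity]
  refine ⟨⟨fun t ↦ (1 - φ t) • g t + φ t • u, by fun_prop⟩, ?_, ?_, ?_⟩
  · refine (norm_le _ zero_le_one).2 fun t ↦ ?_
    have hmem := convex_closedBall (0 : E) 1
      (mem_closedBall_zero_iff.2 ((g.norm_coe_le_norm t).trans hg))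
      (mem_closedBall_zero_iff.2 hu) (sub_nonneg.2 (hφ1 t)) (hφ0 t) (by ring)
    exact mem_closedBall_zero_iff.1 hmem
  · simp [φ]
  · refine (norm_le _ (by positivity)).2 fun t ↦ ?_
    have heq : g t - ((1 - φ t) • g t + φ t • u) = φ t • (g t - u) := by module
    change ‖g t - ((1 - φ t) • g t + φ t • u)‖ ≤ _
    rw [heq, norm_smul_of_nonneg (hφ0 t)]
    rcases le_total ‖g t - g t₀‖ δ with hle | hge
    · calc φ t * ‖g t - u‖ ≤ ‖g t - u‖ := mul_le_of_le_one_left (norm_nonneg _) (hφ1 t)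
        _ ≤ ‖g t - g t₀‖ + ‖g t₀ - u‖ := norm_sub_le_norm_sub_add_norm_sub _ _ _
        _ ≤ ‖g t₀ - u‖ + δ := by linarith
    · have : φ t = 0 := max_eq_left (sub_nonpos.2 ((one_le_div hδ).2 hge))
      rw [this, zero_mul]
      positivity

open ContinuousMap in
/-- Theorem 2.10: if `K` is a compact Hausdorff space and `E` is a GL-space, then the
space `C(K, E)` of continuous `E`-valued functions with the supremum norm is a GL-space. -/
theorem stmt_7 {K : Type*} [TopologicalSpace K] [CompactSpace K] [T2Space K]
    {E : Type*} [NormedAddCommGroup E] [NormedSpace ℝ E] [CompleteSpace E]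
    (hE : IsGLSpace E) :
    IsGLSpace C(K, E) := by
  intro f hf ε hε
  obtain ⟨t₀, ht₀⟩ : ∃ t₀, ‖f t₀‖ = 1 := by
    have : Nonempty K := by
      by_contra hK
      rw [not_nonempty_iff] at hK
      rw [Subsingleton.elim f 0, norm_zero] at hf
      exact zero_ne_one hf
    obtain ⟨t₀, -, hmax⟩ := isCompact_univ.exists_isMaxOn (univ_nonempty (α := K))
      (f := fun t ↦ ‖f t‖) (by fun_prop)
    refine ⟨t₀, le_antisymm (hf ▸ f.norm_coe_le_norm t₀) ?_⟩
    rw [← hf]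
    exact (norm_le _ (norm_nonneg _)).2 fun t ↦ hmax (mem_univ t)
  obtain ⟨φ, hφ, hmem, hlush⟩ := hE (f t₀) ht₀ ε hε
  let F : C(K, E) →L[ℝ] ℝ := φ.comp (evalCLM ℝ t₀)
  have hF (g : C(K, E)) : F g = φ (g t₀) := rfl
  have hFnorm : ‖F‖ = 1 := by
    refine le_antisymm (F.opNorm_le_bound zero_le_one fun g ↦ ?_) ?_
    · rw [hF, one_mul]
      exact (φ.le_of_opNorm_le hφ.le _).trans (by simpa using g.norm_coe_le_norm t₀)
    · rw [← hφ]
      refine φ.opNorm_le_bound (norm_nonneg _) fun v ↦ ?_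
      calc ‖φ v‖ = ‖F (const K v)‖ := rfl
        _ ≤ ‖F‖ * ‖const K v‖ := F.le_opNorm _
        _ ≤ ‖F‖ * ‖v‖ := by
          gcongr
          exact (norm_le _ (norm_nonneg v)).2 fun _ ↦ le_rfl
  refine ⟨F, hFnorm, ⟨hf.le, hmem.2⟩, fun g hg ↦ ?_⟩
  obtain ⟨a, ha, b, hb, hab⟩ :=
    exists_mem_glSlice_norm_add_norm_lt hε hmem hlush ((g.norm_coe_le_norm t₀).trans hg.le)
  obtain ⟨δ, hδ, hδab⟩ : ∃ δ > 0, ‖g t₀ - a‖ + ‖g t₀ - b‖ + 2 * δ < 2 + ε :=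
    ⟨(2 + ε - (‖g t₀ - a‖ + ‖g t₀ - b‖)) / 4, by linarith, by linarith⟩
  have hb' : ‖b‖ ≤ 1 := by simpa using hb.1
  obtain ⟨p, hp, hpa, hgp⟩ := exists_apply_eq_norm_sub_le hg.le t₀ ha.1 hδ
  obtain ⟨q, hq, hqb, hgq⟩ := exists_apply_eq_norm_sub_le hg.le t₀ hb' hδ
  have hpF : p ∈ glSlice F ε := ⟨hp, by rw [hF, hpa]; exact ha.2⟩
  have hqF : q ∈ -(glSlice F ε) :=
    ⟨by rwa [norm_neg], by rw [hF, ContinuousMap.neg_apply, hqb]; exact hb.2⟩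
  have h1 := infDist_le_dist_of_mem (x := g) hpF
  have h2 := infDist_le_dist_of_mem (x := g) hqF
  rw [dist_eq_norm] at h1 h2
  linarith
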